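/- Let M and V be finite-dimensional real representation spaces of a finite group Γ, with V a faithful representation, and let φ be a Γ-equivariant linear map from M onto V. Suppose A ∈ 𝒜(M) and there is a point a ∈ A such that φ(a) has trivial isotropy in V (Σ(φ(a)) = {1}). Then T(A) = {1}, and for each positive integer k there is a set 𝒪 ⊆ C^k_Γ(M), open and dense with respect to the topology induced by the C^k distance, such that Σ(A) = Σ(φ(ψ(A))) for all ψ ∈ 𝒪. -/

import Mathlib

open Pointwise
open scoped ENNReal

/-- The instantaneous (pointwise) symmetry `T(A)` of a set `A`. -/
def instSym (Γ : Type*) [Group Γ] {V : Type*} [MulAction Γ V] (A : Set V) : Subgroup Γ :=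
  ⨅ x ∈ A, MulAction.stabilizer Γ x

/-- The (extended) `C^k` distance between two maps: the supremum over `0 ≤ j ≤ k` and
`x ∈ M` of the operator norms of the `j`-th derivatives of `f - g` at `x`. -/
noncomputable def ckDist {M : Type*} [NormedAddCommGroup M] [NormedSpace ℝ M]
    (k : ℕ) (f g : M → M) : ℝ≥0∞ :=
  ⨆ (j : Fin (k + 1)) (x : M), (‖iteratedFDeriv ℝ (j : ℕ) (f - g) x‖₊ : ℝ≥0∞)

/-- The set `C^k_Γ(M)` of `k`-times continuously differentiable `Γ`-equivariant maps. -/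
def CkEquivariant (Γ : Type*) [Group Γ] (M : Type*) [NormedAddCommGroup M]
    [NormedSpace ℝ M] [MulAction Γ M] (k : ℕ) : Set (M → M) :=
  {ψ : M → M | ContDiff ℝ k ψ ∧ ∀ (γ : Γ) (x : M), ψ (γ • x) = γ • ψ x}

open Set Filter Topology

theorem ck_apply_le {M : Type*} [NormedAddCommGroup M] [NormedSpace ℝ M]
    (k : ℕ) (f g : M → M) (x : M) : edist (f x) (g x) ≤ ckDist k f g := by
  refine le_trans ?_ (le_iSup₂_of_le (f := fun (j : Fin (k + 1)) (x : M) =>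
    (‖iteratedFDeriv ℝ (j : ℕ) (f - g) x‖₊ : ℝ≥0∞)) 0 x le_rfl)
  rw [edist_eq_enorm_sub, enorm_eq_nnnorm]
  have : ‖iteratedFDeriv ℝ 0 (f - g) x‖₊ = ‖f x - g x‖₊ := by
    ext
    simp
  exact_mod_cast this.ge

theorem ck_triangle {M : Type*} [NormedAddCommGroup M] [NormedSpace ℝ M]
    (k : ℕ) (f g h : M → M) (hf : ContDiff ℝ k f) (hg : ContDiff ℝ k g) (hh : ContDiff ℝ k h) :
    ckDist k f h ≤ ckDist k f g + ckDist k g h := by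
  refine iSup₂_le fun j x => ?_
  have hj : ((j : ℕ) : WithTop ℕ∞) ≤ k := by exact_mod_cast Nat.lt_succ_iff.1 j.2
  have e : f - h = (f - g) + (g - h) := by simp
  rw [e, iteratedFDeriv_add_apply (f := f - g) (g := g - h) ((hf.sub hg).of_le hj).contDiffAt
    ((hg.sub hh).of_le hj).contDiffAt]
  refine le_trans (b := (‖iteratedFDeriv ℝ (j : ℕ) (f - g) x‖₊ : ℝ≥0∞) +
    ‖iteratedFDeriv ℝ (j : ℕ) (g - h) x‖₊) ?_ (add_le_add ?_ ?_)
  · exact_mod_cast nnnorm_add_le _ _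
  · exact le_iSup₂_of_le (f := fun (j : Fin (k + 1)) (x : M) =>
      (‖iteratedFDeriv ℝ (j : ℕ) (f - g) x‖₊ : ℝ≥0∞)) j x le_rfl
  · exact le_iSup₂_of_le (f := fun (j : Fin (k + 1)) (x : M) =>
      (‖iteratedFDeriv ℝ (j : ℕ) (g - h) x‖₊ : ℝ≥0∞)) j x le_rfl

theorem ck_small {M : Type*} [NormedAddCommGroup M] [NormedSpace ℝ M]
    (k : ℕ) (f g : M → M) (hg : ContDiff ℝ k g) (hc : HasCompactSupport g)
    (ε : ℝ≥0∞) (hε : 0 < ε) :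
    ∃ d : ℝ, 0 < d ∧ ∀ t : ℝ, 0 < t → t < d → ckDist k (f + t • g) f < ε := by
  have hb : ∀ j : Fin (k + 1), ∃ C : ℝ, ∀ x, ‖iteratedFDeriv ℝ (j : ℕ) g x‖ ≤ C := fun j => by
    have hj : ((j : ℕ) : WithTop ℕ∞) ≤ k := by exact_mod_cast Nat.lt_succ_iff.1 j.2
    exact (hc.iteratedFDeriv (𝕜 := ℝ) j).exists_bound_of_continuous
      (hg.continuous_iteratedFDeriv hj)
  choose C hC using hb
  obtain ⟨B, hB⟩ : ∃ B : ℝ, ∀ j, C j ≤ B := by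
    obtain ⟨B, hB⟩ := (Set.finite_range C).bddAbove
    exact ⟨B, fun j => hB ⟨j, rfl⟩⟩
  set D : ℝ := max B 1
  have hD : 0 < D := lt_of_lt_of_le one_pos (le_max_right _ _)
  obtain ⟨e, he0, he⟩ : ∃ e : ℝ, 0 < e ∧ ENNReal.ofReal e < ε := by
    obtain ⟨e, he0, he⟩ := ENNReal.lt_iff_exists_nnreal_btwn.1 hε
    exact ⟨e, by exact_mod_cast he0, by simpa using he⟩
  refine ⟨e / D, by positivity, fun t ht0 ht => lt_of_le_of_lt ?_ he⟩
  refine iSup₂_le fun j x => ?_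
  have hj : ((j : ℕ) : WithTop ℕ∞) ≤ k := by exact_mod_cast Nat.lt_succ_iff.1 j.2
  rw [add_sub_cancel_left, iteratedFDeriv_const_smul_apply (hg.of_le hj).contDiffAt,
    ← enorm_eq_nnnorm, ← ofReal_norm]
  apply ENNReal.ofReal_le_ofReal
  rw [norm_smul, Real.norm_of_nonneg ht0.le]
  rw [lt_div_iff₀ hD] at ht
  calc t * _ ≤ t * D := by
        gcongr
        exact (hC j x).trans ((hB j).trans (le_max_left _ _))
    _ ≤ e := ht.le

section
variable {Γ M : Type*} [Group Γ] [NormedAddCommGroup M] [NormedSpace ℝ M]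
  [FiniteDimensional ℝ M] [DistribMulAction Γ M] [SMulCommClass Γ ℝ M]

theorem smul_contDiff (γ : Γ) {n : WithTop ℕ∞} : ContDiff ℝ n (fun x : M => γ • x) :=
  ((DistribSMul.toLinearMap ℝ M γ).toContinuousLinearMap).contDiff

theorem smul_cont (γ : Γ) : Continuous (fun x : M => γ • x) :=
  (smul_contDiff γ (n := 0)).continuous

theorem exists_inv_bump [Finite Γ] (k : ℕ) (x : M) :
    ∃ η : M → ℝ, ContDiff ℝ k η ∧ HasCompactSupport η ∧ (∀ (γ : Γ) y, η (γ • y) = η y) ∧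
      (∀ y, 0 ≤ η y) ∧ (∀ y, η y ≤ 1) ∧ (∀ y, η y = 1 ↔ y ∈ MulAction.orbit Γ x) := by
  classical
  cases nonempty_fintype Γ
  have hfin : (MulAction.orbit Γ x).Finite := Set.finite_range _
  obtain ⟨R, hR⟩ := hfin.isBounded.subset_ball (0 : M)
  obtain ⟨f, fd, fr, f0, f1⟩ := exists_contMDiff_zero_iff_one_iff_of_isClosed
    (n := (⊤ : ℕ∞)) (modelWithCornersSelf ℝ M)
    (Metric.isOpen_ball (x := (0 : M)) (ε := R)).isClosed_compl hfin.isClosed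
    (Set.disjoint_left.2 fun y hy hy' => hy (hR hy'))
  have fd' : ContDiff ℝ k f := (contMDiff_iff_contDiff.1 fd).of_le (by exact_mod_cast le_top)
  have fr' : ∀ y, 0 ≤ f y ∧ f y ≤ 1 := fun y => fr ⟨y, rfl⟩
  have hN : (0 : ℝ) < Fintype.card Γ := by exact_mod_cast Fintype.card_pos
  refine ⟨fun y => (∑ γ : Γ, f (γ • y)) / Fintype.card Γ, ?_, ?_, ?_, ?_, ?_, ?_⟩
  · exact (ContDiff.sum fun γ _ => fd'.comp (smul_contDiff γ)).div_const _
  · refine HasCompactSupport.intro (K := ⋃ γ : Γ, (fun z : M => γ • z) '' Metric.closedBall 0 R)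
      (isCompact_iUnion fun γ => (isCompact_closedBall _ _).image (smul_cont γ)) ?_
    intro y hy
    have : ∀ γ : Γ, f (γ • y) = 0 := by
      intro γ
      rw [← f0]
      intro hb
      apply hy
      exact Set.mem_iUnion.2 ⟨γ⁻¹, γ • y, Metric.ball_subset_closedBall hb, by simp⟩
    simp [this]
  · intro γ y
    dsimp only
    congr 1
    simp_rw [← mul_smul]
    exact Equiv.sum_comp (Equiv.mulRight γ) (fun g => f (g • y))
  · intro y
    exact div_nonneg (Finset.sum_nonneg fun γ _ => (fr' _).1) hN.le
  · intro y
    rw [div_le_one hN]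
    calc _ ≤ ∑ γ : Γ, (1 : ℝ) := Finset.sum_le_sum fun γ _ => (fr' _).2
      _ = _ := by simp
  · intro y
    rw [div_eq_one_iff_eq hN.ne']
    constructor
    · intro h
      have h2 : ∑ γ : Γ, f (γ • y) = ∑ γ : Γ, (1 : ℝ) := by simpa using h
      have := (Finset.sum_eq_sum_iff_of_le (fun γ _ => (fr' (γ • y)).2)).1 h2 1 (Finset.mem_univ _)
      rw [one_smul] at this
      exact (f1 y).2 this
    · intro h
      have : ∀ γ : Γ, f (γ • y) = 1 := fun γ => (f1 _).1 (by
        rw [MulAction.mem_orbit_iff] at h ⊢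
        obtain ⟨g, rfl⟩ := h
        exact ⟨γ * g, by rw [mul_smul]⟩)
      simp [this]

/-- A nonnegative invariant homogeneous function vanishing exactly at points with isotropy. -/
theorem exists_height [Finite Γ] (hnt : Nontrivial Γ) :
    ∃ (p : M → ℝ) (m : ℕ), m ≠ 0 ∧ Continuous p ∧ (∀ v, 0 ≤ p v) ∧
      (∀ (γ : Γ) v, p (γ • v) = p v) ∧ (∀ (c : ℝ) v, 0 ≤ c → p (c • v) = c ^ m * p v) ∧
      (∀ v, p v ≠ 0 ↔ ∀ γ : Γ, γ • v = v → γ = 1) := by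
  classical
  cases nonempty_fintype Γ
  set N : M → ℝ := fun v => ∑ γ : Γ, ‖γ • v‖ with hN
  have Ncont : Continuous N := continuous_finsetSum _ fun γ _ => (smul_cont γ).norm
  have Nnn : ∀ v, 0 ≤ N v := fun v => Finset.sum_nonneg fun γ _ => norm_nonneg _
  have Ninv : ∀ (γ : Γ) v, N (γ • v) = N v := by
    intro γ v
    simp_rw [hN, ← mul_smul]
    exact Equiv.sum_comp (Equiv.mulRight γ) (fun g : Γ => ‖g • v‖)
  have Nhom : ∀ (c : ℝ) v, 0 ≤ c → N (c • v) = c * N v := by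
    intro c v hc
    simp_rw [hN, smul_comm _ c v, norm_smul, Real.norm_of_nonneg hc, Finset.mul_sum]
  have N0 : ∀ v, N v = 0 ↔ v = 0 := by
    intro v
    constructor
    · intro h
      have := (Finset.sum_eq_zero_iff_of_nonneg (fun γ _ => norm_nonneg _)).1 h 1
        (Finset.mem_univ _)
      simpa using this
    · rintro rfl
      simp [hN]
  refine ⟨fun v => ∏ γ ∈ Finset.univ.erase (1 : Γ), N (γ • v - v),
    (Finset.univ.erase (1 : Γ)).card, ?_, ?_, ?_, ?_, ?_, ?_⟩
  · obtain ⟨g, hg⟩ := exists_ne (1 : Γ)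
    exact Finset.card_ne_zero_of_mem (Finset.mem_erase.2 ⟨hg, Finset.mem_univ g⟩)
  · exact continuous_finsetProd _ fun γ _ => Ncont.comp ((smul_cont γ).sub continuous_id)
  · exact fun v => Finset.prod_nonneg fun γ _ => Nnn _
  · intro h v
    refine Finset.prod_bij' (fun γ _ => h⁻¹ * γ * h) (fun γ _ => h * γ * h⁻¹) ?_ ?_ ?_ ?_ ?_
    · intro γ hγ
      simp only [Finset.mem_erase, Finset.mem_univ, and_true] at hγ ⊢
      intro e
      apply hγ
      have : γ = h * (h⁻¹ * γ * h) * h⁻¹ := by group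
      rw [this, e]
      group
    · intro γ hγ
      simp only [Finset.mem_erase, Finset.mem_univ, and_true] at hγ ⊢
      intro e
      apply hγ
      have : γ = h⁻¹ * (h * γ * h⁻¹) * h := by group
      rw [this, e]
      group
    · intro γ _
      group
    · intro γ _
      group
    · intro γ _
      rw [← Ninv h⁻¹ (γ • h • v - h • v), smul_sub]
      simp [mul_smul]
  · intro c v hc
    have : ∀ γ : Γ, γ • c • v - c • v = c • (γ • v - v) := fun γ => by
      rw [smul_comm γ c v, smul_sub]
    simp_rw [this, Nhom c _ hc, Finset.prod_mul_distrib, Finset.prod_const]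
  · intro v
    simp only [ne_eq, Finset.prod_eq_zero_iff, N0, sub_eq_zero, Finset.mem_erase,
      Finset.mem_univ, and_true, not_exists, not_and]
    exact forall_congr' fun γ => ⟨fun h e => by_contra fun n => h n e, fun h n e => n (h e)⟩

end

section
variable {Γ M V : Type*} [Group Γ] [Finite Γ]
    [NormedAddCommGroup M] [NormedSpace ℝ M] [FiniteDimensional ℝ M]
    [NormedAddCommGroup V] [NormedSpace ℝ V] [FiniteDimensional ℝ V]
    [DistribMulAction Γ M] [SMulCommClass Γ ℝ M]
    [DistribMulAction Γ V] [SMulCommClass Γ ℝ V]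

theorem ck_perturb {k : ℕ} {ψ : M → M} (hψ : ψ ∈ CkEquivariant Γ M k) {η : M → ℝ}
    (h1 : ContDiff ℝ k η) (h3 : ∀ (γ : Γ) y, η (γ • y) = η y) {u : M → M}
    (hu : u ∈ CkEquivariant Γ M k) (t : ℝ) :
    ψ + t • (fun y => η y • u y) ∈ CkEquivariant Γ M k := by
  refine ⟨hψ.1.add ((h1.smul hu.1).const_smul t), fun γ x => ?_⟩
  simp only [Pi.add_apply, Pi.smul_apply, hψ.2, hu.2, h3, smul_add, smul_comm γ]

/-- First perturbation. -/
theorem dense_step1 (φ : M →ₗ[ℝ] V) (a : M) (haTriv : ∀ γ : Γ, γ • φ a = φ a → γ = 1)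
    (k : ℕ) (ψ : M → M) (hψ : ψ ∈ CkEquivariant Γ M k) (ε : ℝ≥0∞) (hε : 0 < ε) :
    ∃ ψ' ∈ CkEquivariant Γ M k, ckDist k ψ' ψ < ε ∧ ∀ γ : Γ, γ • φ (ψ' a) = φ (ψ' a) → γ = 1 := by
  obtain ⟨η, h1, h2, h3, h4, h5, h6⟩ := exists_inv_bump (Γ := Γ) k a
  have hid : (id : M → M) ∈ CkEquivariant Γ M k := ⟨contDiff_id, fun _ _ => rfl⟩
  obtain ⟨d, hd, H⟩ := ck_small k ψ (fun y => η y • id y) (h1.smul contDiff_id) h2.smul_right ε hε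
  have ha1 : η a = 1 := (h6 a).2 (MulAction.mem_orbit_self a)
  have hbad : (⋃ γ ∈ {γ : Γ | γ ≠ 1},
      {t : ℝ | γ • (φ (ψ a) + t • φ a) = φ (ψ a) + t • φ a}).Finite := by
    refine Set.Finite.biUnion (Set.toFinite _) fun γ hγ => Set.Subsingleton.finite ?_
    intro s hs t ht
    by_contra hst
    apply hγ
    apply haTriv
    simp only [Set.mem_ofPred_eq, smul_add, smul_comm γ] at hs ht
    have e : (s - t) • (γ • φ a - φ a) = 0 := by
      have : (s - t) • (γ • φ a - φ a) = (γ • φ (ψ a) + s • γ • φ a - (φ (ψ a) + s • φ a))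
        - (γ • φ (ψ a) + t • γ • φ a - (φ (ψ a) + t • φ a)) := by
        generalize γ • φ a = w
        generalize γ • φ (ψ a) = w'
        module
      rw [this, hs, ht]
      simp
    rcases smul_eq_zero.1 e with h | h
    · exact absurd (sub_eq_zero.1 h) hst
    · exact sub_eq_zero.1 h
  obtain ⟨t, ht, htn⟩ := ((Set.Ioo_infinite hd).sdiff hbad).nonempty
  refine ⟨_, ck_perturb hψ h1 h3 hid t, H t ht.1 ht.2, fun γ hγ => ?_⟩
  by_contra hne
  apply htn
  refine Set.mem_biUnion (x := γ) hne ?_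
  simpa [ha1] using hγ

/-- Second perturbation. -/
theorem dense_step2 (φ : M →ₗ[ℝ] V) (hequiv : ∀ (γ : Γ) (x : M), φ (γ • x) = γ • φ x)
    (A : Set M) (hcpt : IsCompact A) (hdich : ∀ γ : Γ, γ • A = A ∨ (γ • A) ∩ A = ∅)
    (a : M) (ha : a ∈ A)
    (k : ℕ) (ψ : M → M) (hψ : ψ ∈ CkEquivariant Γ M k)
    (haTriv : ∀ γ : Γ, γ • φ (ψ a) = φ (ψ a) → γ = 1) (ε : ℝ≥0∞) (hε : 0 < ε) (hnt : Nontrivial Γ) :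
    ∃ ψ' ∈ CkEquivariant Γ M k, ckDist k ψ' ψ < ε ∧
      MulAction.stabilizer Γ (φ '' (ψ' '' A)) ≤ MulAction.stabilizer Γ A := by
  obtain ⟨p, m, hm, pc, pnn, pinv, phom, pz⟩ := exists_height (Γ := Γ) (M := V) hnt
  have φc : Continuous φ := φ.continuous_of_finiteDimensional
  obtain ⟨x, hxA, hx⟩ := hcpt.exists_isMaxOn ⟨a, ha⟩
    ((pc.comp (φc.comp hψ.1.continuous)).continuousOn)
  have hmax : ∀ y ∈ A, p (φ (ψ y)) ≤ p (φ (ψ x)) := fun y hy => hx hy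
  have hpos : 0 < p (φ (ψ x)) :=
    lt_of_lt_of_le ((pnn _).lt_of_ne' ((pz _).2 haTriv)) (hmax a ha)
  obtain ⟨η, h1, h2, h3, h4, h5, h6⟩ := exists_inv_bump (Γ := Γ) k x
  obtain ⟨d, hd, H⟩ := ck_small k ψ (fun y => η y • ψ y) (h1.smul hψ.1) h2.smul_right ε hε
  obtain ⟨t, ht0, htd⟩ := exists_between hd
  have hmem := ck_perturb hψ h1 h3 hψ t
  refine ⟨_, hmem, H t ht0 htd, ?_⟩
  set ψ' := ψ + t • (fun y => η y • ψ y) with hψ'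
  have hval : ∀ y, φ (ψ' y) = (1 + t * η y) • φ (ψ y) := by
    intro y
    simp [hψ', add_smul, mul_smul]
  have hp : ∀ y, p (φ (ψ' y)) = (1 + t * η y) ^ m * p (φ (ψ y)) := by
    intro y
    rw [hval, phom _ _ (by have := h4 y; positivity)]
  have hx1 : η x = 1 := (h6 x).2 (MulAction.mem_orbit_self x)
  intro γ hγ
  rw [MulAction.mem_stabilizer_iff] at hγ ⊢
  have hin : γ • φ (ψ' x) ∈ φ '' (ψ' '' A) := by
    rw [← hγ]
    exact Set.smul_mem_smul_set ⟨_, ⟨x, hxA, rfl⟩, rfl⟩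
  obtain ⟨_, ⟨y, hyA, rfl⟩, hy⟩ := hin
  have hpe : p (φ (ψ' y)) = p (φ (ψ' x)) := by rw [hy, pinv]
  have hy1 : η y = 1 := by
    by_contra hne
    have hlt : η y < 1 := lt_of_le_of_ne (h5 y) hne
    rw [hp, hp, hx1] at hpe
    have h4y := h4 y
    have l1 : (1 + t * η y) ^ m < (1 + t * 1) ^ m :=
      pow_lt_pow_left₀ (by nlinarith) (by positivity) hm
    have l2 : (1 + t * η y) ^ m * p (φ (ψ y)) ≤ (1 + t * η y) ^ m * p (φ (ψ x)) :=
      mul_le_mul_of_nonneg_left (hmax y hyA) (by positivity)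
    have l3 := mul_lt_mul_of_pos_right l1 hpos
    linarith
  obtain ⟨h, rfl⟩ := (h6 y).1 hy1
  dsimp only at hy hyA
  have hiso : ∀ g : Γ, g • φ (ψ' x) = φ (ψ' x) → g = 1 := by
    rw [← pz, hp]
    have := h4 x
    positivity
  have hgh : h⁻¹ * γ = 1 := by
    apply hiso
    rw [mul_smul, ← hy, hmem.2, hequiv, inv_smul_smul]
  have : γ = h := (inv_mul_eq_one.1 hgh).symm
  subst this
  rcases hdich γ with e | e
  · exact e
  · exact absurd (show γ • x ∈ (γ • A) ∩ A from ⟨Set.smul_mem_smul_set hxA, hyA⟩) (by simp [e])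

theorem image_smul_eq (φ : M →ₗ[ℝ] V) (hequiv : ∀ (γ : Γ) (x : M), φ (γ • x) = γ • φ x)
    {k : ℕ} {ψ : M → M} (hψ : ψ ∈ CkEquivariant Γ M k) (A : Set M) (γ : Γ) :
    γ • (φ '' (ψ '' A)) = φ '' (ψ '' (γ • A)) := by
  simp only [← Set.image_smul, Set.image_image, hψ.2, hequiv]

theorem stab_le (φ : M →ₗ[ℝ] V) (hequiv : ∀ (γ : Γ) (x : M), φ (γ • x) = γ • φ x)
    {k : ℕ} {ψ : M → M} (hψ : ψ ∈ CkEquivariant Γ M k) (A : Set M) :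
    MulAction.stabilizer Γ A ≤ MulAction.stabilizer Γ (φ '' (ψ '' A)) := by
  intro γ hγ
  rw [MulAction.mem_stabilizer_iff] at hγ ⊢
  rw [image_smul_eq φ hequiv hψ, hγ]

theorem open_step (φ : M →ₗ[ℝ] V) {A B : Set M} (hA : IsCompact A) (hB : IsCompact B)
    {k : ℕ} {ψ : M → M} (hψ : ContDiff ℝ k ψ) (hne : φ '' (ψ '' B) ≠ φ '' (ψ '' A)) :
    ∃ ε : ℝ≥0∞, 0 < ε ∧ ∀ ψ' : M → M, ckDist k ψ' ψ < ε → φ '' (ψ' '' B) ≠ φ '' (ψ' '' A) := by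
  have φc : Continuous φ := φ.continuous_of_finiteDimensional
  have cl : ∀ {S : Set M}, IsCompact S → IsClosed (φ '' (ψ '' S)) := fun h =>
    ((h.image hψ.continuous).image φc).isClosed
  set d := Metric.hausdorffEDist (φ '' (ψ '' B)) (φ '' (ψ '' A)) with hd
  have hd0 : d ≠ 0 := fun h => hne (((cl hB).hausdorffEDist_zero_iff (cl hA)).1 h)
  set L : M →L[ℝ] V := φ.toContinuousLinearMap
  have hL : ∀ u v : M, edist (φ u) (φ v) ≤ ‖L‖₊ * edist u v := fun u v => L.lipschitz u v
  have hC : (2 * (‖L‖₊ + 1) : ℝ≥0∞) ≠ ⊤ := by finiteness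
  refine ⟨d / (2 * (‖L‖₊ + 1)), ENNReal.div_pos hd0 hC, fun ψ' hlt heq => ?_⟩
  have key : ∀ S : Set M, Metric.hausdorffEDist (φ '' (ψ '' S)) (φ '' (ψ' '' S)) ≤
      (‖L‖₊ + 1) * ckDist k ψ' ψ := by
    intro S
    have b : ∀ x, edist (φ (ψ' x)) (φ (ψ x)) ≤ (‖L‖₊ + 1) * ckDist k ψ' ψ := fun x =>
      (hL _ _).trans (mul_le_mul' le_self_add (ck_apply_le k ψ' ψ x))
    apply Metric.hausdorffEDist_le_of_mem_edist
    · rintro _ ⟨_, ⟨x, hx, rfl⟩, rfl⟩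
      exact ⟨_, ⟨_, ⟨x, hx, rfl⟩, rfl⟩, by rw [edist_comm]; exact b x⟩
    · rintro _ ⟨_, ⟨x, hx, rfl⟩, rfl⟩
      exact ⟨_, ⟨_, ⟨x, hx, rfl⟩, rfl⟩, b x⟩
  have tri : d ≤ (‖L‖₊ + 1) * ckDist k ψ' ψ + (‖L‖₊ + 1) * ckDist k ψ' ψ := by
    refine (Metric.hausdorffEDist_triangle (t := φ '' (ψ' '' B))).trans (add_le_add (key B) ?_)
    rw [heq, Metric.hausdorffEDist_comm]
    exact key A
  have hlt2 := ENNReal.mul_lt_of_lt_div hlt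
  refine absurd tri (not_le.2 (lt_of_eq_of_lt ?_ hlt2))
  ring

end

/-- If `V` is a faithful representation, `φ : M → V` an equivariant linear surjection,
`A ∈ 𝒜(M)`, and some `a ∈ A` has `Σ(φ(a)) = 1`, then `T(A) = 1` and for each `k ≥ 1`
there is a subset `𝒪` of `C^k_Γ(M)`, open and dense for the `C^k` distance, with
`Σ(A) = Σ(φ(ψ(A)))` for all `ψ ∈ 𝒪`. -/
theorem generic_projection_faithful_case {Γ M V : Type*} [Group Γ] [Finite Γ]
    [NormedAddCommGroup M] [NormedSpace ℝ M] [FiniteDimensional ℝ M]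
    [NormedAddCommGroup V] [NormedSpace ℝ V] [FiniteDimensional ℝ V]
    [DistribMulAction Γ M] [SMulCommClass Γ ℝ M]
    [DistribMulAction Γ V] [SMulCommClass Γ ℝ V]
    (hfaithful : ∀ γ : Γ, (∀ v : V, γ • v = v) → γ = 1)
    (φ : M →ₗ[ℝ] V) (hsurj : Function.Surjective φ)
    (hequiv : ∀ (γ : Γ) (x : M), φ (γ • x) = γ • φ x)
    (A : Set M) (hcpt : IsCompact A)
    (hdich : ∀ γ : Γ, γ • A = A ∨ (γ • A) ∩ A = ∅)
    (a : M) (ha : a ∈ A) (haTriv : MulAction.stabilizer Γ (φ a) = ⊥) :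
    instSym Γ A = ⊥ ∧
      ∀ k : ℕ, 0 < k →
        ∃ O ⊆ CkEquivariant Γ M k,
          (∀ ψ ∈ O, ∃ ε : ℝ≥0∞, 0 < ε ∧
            ∀ ψ' ∈ CkEquivariant Γ M k, ckDist k ψ' ψ < ε → ψ' ∈ O) ∧
          (∀ ψ ∈ CkEquivariant Γ M k, ∀ ε : ℝ≥0∞, 0 < ε →
            ∃ ψ' ∈ O, ckDist k ψ' ψ < ε) ∧
          (∀ ψ ∈ O,
            MulAction.stabilizer Γ A = MulAction.stabilizer Γ (φ '' (ψ '' A))) := by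
  have htriv : ∀ γ : Γ, γ • φ a = φ a → γ = 1 := fun γ h => by
    have : γ ∈ MulAction.stabilizer Γ (φ a) := h
    rw [haTriv] at this
    exact Subgroup.mem_bot.1 this
  refine ⟨?_, fun k _ => ?_⟩
  · rw [eq_bot_iff]
    intro γ hγ
    simp only [instSym, Subgroup.mem_iInf, MulAction.mem_stabilizer_iff] at hγ
    exact Subgroup.mem_bot.2 (htriv γ (by rw [← hequiv, hγ a ha]))
  refine ⟨{ψ | ψ ∈ CkEquivariant Γ M k ∧
    MulAction.stabilizer Γ A = MulAction.stabilizer Γ (φ '' (ψ '' A))}, fun ψ h => h.1, ?_, ?_,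
    fun ψ h => h.2⟩
  · rintro ψ ⟨hψ, hst⟩
    have hex : ∀ γ : Γ, ∃ ε : ℝ≥0∞, 0 < ε ∧ (γ ∉ MulAction.stabilizer Γ A →
        ∀ ψ' : M → M, ckDist k ψ' ψ < ε → φ '' (ψ' '' (γ • A)) ≠ φ '' (ψ' '' A)) := by
      intro γ
      by_cases hγ : γ ∈ MulAction.stabilizer Γ A
      · exact ⟨1, one_pos, fun h => absurd hγ h⟩
      · obtain ⟨ε, h0, h⟩ := open_step φ hcpt (B := γ • A) (hcpt.image (smul_cont γ)) hψ.1
          (by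
            rw [← image_smul_eq φ hequiv hψ]
            rw [hst] at hγ
            exact hγ)
        exact ⟨ε, h0, fun _ => h⟩
    choose e he0 he using hex
    cases nonempty_fintype Γ
    refine ⟨Finset.univ.inf e, (Finset.lt_inf_iff (by simp)).2 fun γ _ => he0 γ,
      fun ψ' hψ' hlt => ⟨hψ', le_antisymm (stab_le φ hequiv hψ' A) fun γ hγ => ?_⟩⟩
    by_contra hn
    refine he γ hn ψ' (hlt.trans_le (Finset.inf_le (Finset.mem_univ γ))) ?_
    rw [← image_smul_eq φ hequiv hψ']
    exact hγ
  · intro ψ hψ ε hε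
    rcases subsingleton_or_nontrivial Γ with hs | hnt
    · obtain ⟨ψ', h', hd, -⟩ := dense_step1 φ a htriv k ψ hψ ε hε
      exact ⟨ψ', ⟨h', Subsingleton.elim _ _⟩, hd⟩
    · have hε2 : 0 < ε / 2 := ENNReal.half_pos hε.ne'
      obtain ⟨ψ₁, h₁, d₁, t₁⟩ := dense_step1 φ a htriv k ψ hψ (ε / 2) hε2
      obtain ⟨ψ₂, h₂, d₂, t₂⟩ := dense_step2 φ hequiv A hcpt hdich a ha k ψ₁ h₁ t₁ (ε / 2) hε2 hnt
      refine ⟨ψ₂, ⟨h₂, le_antisymm (stab_le φ hequiv h₂ A) t₂⟩, ?_⟩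
      calc ckDist k ψ₂ ψ ≤ _ := ck_triangle k ψ₂ ψ₁ ψ h₂.1 h₁.1 hψ.1
        _ < ε / 2 + ε / 2 := ENNReal.add_lt_add d₂ d₁
        _ = ε := ENNReal.add_halves ε
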